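/- Work in R := ℂ[X₀,X₁,X₂]. Set A := 2X₁X₂⁵, B := −7X₁⁵X₂ − 3X₀X₂⁵ + X₁X₂⁵, C := 7X₁⁶ + X₀X₁X₂⁴ − X₁²X₂⁴, and Ω := (A,B,C). Set F := X₁³X₂⁷ and G := X₁¹⁰ − 2X₀X₁⁵X₂⁴ + 2X₁⁶X₂⁴ + X₀²X₂⁸ − 2X₀X₁X₂⁸ + X₁²X₂⁸. Then: (i) X₀A + X₁B + X₂C = 0 (Euler condition), and (ii) Ω ∧ (G·dF − F·dG) = 0, i.e. the three minors A·(G∂₁F − F∂₁G) − B·(G∂₀F − F∂₀G), A·(G∂₂F − F∂₂G) − C·(G∂₀F − F∂₀G), and B·(G∂₂F − F∂₂G) − C·(G∂₁F − F∂₁G) all vanish. -/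

import Mathlib

open MvPolynomial

namespace Stmt8

noncomputable def A : MvPolynomial (Fin 3) ℂ := 2 * X 1 * X 2 ^ 5

noncomputable def B : MvPolynomial (Fin 3) ℂ :=
  -7 * X 1 ^ 5 * X 2 - 3 * X 0 * X 2 ^ 5 + X 1 * X 2 ^ 5

noncomputable def C' : MvPolynomial (Fin 3) ℂ :=
  7 * X 1 ^ 6 + X 0 * X 1 * X 2 ^ 4 - X 1 ^ 2 * X 2 ^ 4

noncomputable def F : MvPolynomial (Fin 3) ℂ := X 1 ^ 3 * X 2 ^ 7

noncomputable def G : MvPolynomial (Fin 3) ℂ :=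
  X 1 ^ 10 - 2 * X 0 * X 1 ^ 5 * X 2 ^ 4 + 2 * X 1 ^ 6 * X 2 ^ 4
    + X 0 ^ 2 * X 2 ^ 8 - 2 * X 0 * X 1 * X 2 ^ 8 + X 1 ^ 2 * X 2 ^ 8

theorem G_eq_sq : G = (X 1 ^ 5 - X 0 * X 2 ^ 4 + X 1 * X 2 ^ 4) ^ 2 := by
  unfold G
  ring

theorem pderiv_zero_F : pderiv 0 F = 0 := by
  simp [F, pderiv_X]

theorem pderiv_one_F : pderiv 1 F = 3 * X 1 ^ 2 * X 2 ^ 7 := by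
  simp [F, pderiv_X]
  ring

theorem pderiv_two_F : pderiv 2 F = 7 * X 1 ^ 3 * X 2 ^ 6 := by
  simp [F, pderiv_X]
  ring

theorem pderiv_zero_G :
    pderiv 0 G = -2 * X 2 ^ 4 * (X 1 ^ 5 - X 0 * X 2 ^ 4 + X 1 * X 2 ^ 4) := by
  simp [G_eq_sq, pderiv_X]
  ring

theorem pderiv_one_G :
    pderiv 1 G =
      2 * (5 * X 1 ^ 4 + X 2 ^ 4) * (X 1 ^ 5 - X 0 * X 2 ^ 4 + X 1 * X 2 ^ 4) := by
  simp [G_eq_sq, pderiv_X]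
  ring

theorem pderiv_two_G :
    pderiv 2 G =
      8 * X 2 ^ 3 * (X 1 - X 0) * (X 1 ^ 5 - X 0 * X 2 ^ 4 + X 1 * X 2 ^ 4) := by
  simp [G_eq_sq, pderiv_X]
  ring

/-- Example 1 of the paper: the 1-form `Ω = (A,B,C)` satisfies the Euler condition
and admits the rational first integral with components `F` and `G`, i.e.
`Ω ∧ (G dF − F dG) = 0`. -/
theorem stmt_8 :
    (X 0 * A + X 1 * B + X 2 * C' = 0) ∧
    (A * (G * pderiv 1 F - F * pderiv 1 G)
      - B * (G * pderiv 0 F - F * pderiv 0 G) = 0) ∧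
    (A * (G * pderiv 2 F - F * pderiv 2 G)
      - C' * (G * pderiv 0 F - F * pderiv 0 G) = 0) ∧
    (B * (G * pderiv 2 F - F * pderiv 2 G)
      - C' * (G * pderiv 1 F - F * pderiv 1 G) = 0) := by
  rw [pderiv_zero_F, pderiv_one_F, pderiv_two_F, pderiv_zero_G, pderiv_one_G, pderiv_two_G,
    G_eq_sq]
  unfold A B C' F
  refine ⟨?_, ?_, ?_, ?_⟩ <;> ring

end Stmt8
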